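/- (High-frequency energy estimate for linearized Einstein–scalar field.) Let τ̊ ≥ 1 be as in the coercivity of the high-frequency Einstein energy. Let λ ∈ ℤ^D \ {0} and let (η, κ, φ, ψ, ν, X) be a λ-mode CMCSH solution of the linearized Einstein–scalar field system on (0,∞). Then: (i) there is C > 0 depending only on D, p_1,…,p_D, p_φ such that for every t with τ(t) ≥ τ̊, |t·(d/dt)E_high(t)| ≤ C·(t|ζ′(t)| + τ(t)^{−1})·E_high(t); (ii) there is C̊_high > 0 depending only on D, p_1,…,p_D, p_φ such that if |λ| = τ(1) ≥ τ̊, then for every t with τ(t) ≥ τ̊: C̊_high^{−1}·E_high(t) ≤ E_high(1) ≤ C̊_high·E_high(t). -/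

import Mathlib

open Real Filter MeasureTheory Topology

/-- τ_λ(t) = (∑ᵢ t^(2-2pᵢ) λᵢ²)^(1/2). -/
noncomputable def tau {D : ℕ} (p : Fin D → ℝ) (lam : Fin D → ℤ) (t : ℝ) : ℝ :=
  Real.sqrt (∑ i, t ^ (2 - 2 * p i) * ((lam i : ℝ)) ^ 2)

/-- ζ_λ(t) = 2τ_λ(t)² / ∑ᵢ (2-2pᵢ) t^(2-2pᵢ) λᵢ². -/
noncomputable def zeta {D : ℕ} (p : Fin D → ℝ) (lam : Fin D → ℤ) (t : ℝ) : ℝ :=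
  2 * tau p lam t ^ 2 / ∑ i, (2 - 2 * p i) * t ^ (2 - 2 * p i) * ((lam i : ℝ)) ^ 2

/-- A λ-mode CMCSH solution of the linearized Einstein–scalar field system on (0,∞):
the real form of the projection of the linearized system in the
constant-mean-curvature spatially-harmonic gauge onto the Fourier mode λ
(the Fourier coefficient of the shift being χ^j = i·X^j). -/
structure IsCMCSHSolution {D : ℕ} (p : Fin D → ℝ) (pphi : ℝ) (lam : Fin D → ℤ)
    (η κ : ℝ → Fin D → Fin D → ℝ) (φ ψ ν : ℝ → ℝ) (X : ℝ → Fin D → ℝ) : Prop where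
  cont_nu : ContinuousOn ν (Set.Ioi 0)
  cont_X : ∀ j, ContinuousOn (fun t => X t j) (Set.Ioi 0)
  eta_evol : ∀ t ∈ Set.Ioi (0:ℝ), ∀ i j, HasDerivAt (fun s => η s i j)
    ((κ t i j + 2 * (p i - p j) * η t i j - p i * (if i = j then 1 else 0) * ν t
      - (1/2) * (lam i : ℝ) * X t j
      - (1/2) * t ^ (2 * p i - 2 * p j) * (lam j : ℝ) * X t i) / t) t
  kappa_evol : ∀ t ∈ Set.Ioi (0:ℝ), ∀ i j, HasDerivAt (fun s => κ s i j)
    ((-(tau p lam t ^ 2) * η t i j + t ^ (2 - 2 * p j) * (lam i : ℝ) * (lam j : ℝ) * ν t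
      + p i * (if i = j then 1 else 0) * ν t + (p i - p j) * (lam i : ℝ) * X t j) / t) t
  phi_evol : ∀ t ∈ Set.Ioi (0:ℝ), HasDerivAt φ ((ψ t + pphi * ν t) / t) t
  psi_evol : ∀ t ∈ Set.Ioi (0:ℝ), HasDerivAt ψ ((-(tau p lam t ^ 2) * φ t - pphi * ν t) / t) t
  nu_elliptic : ∀ t ∈ Set.Ioi (0:ℝ),
    (1 + tau p lam t ^ 2) * ν t = tau p lam t ^ 2 * ∑ a, η t a a
  X_elliptic : ∀ t ∈ Set.Ioi (0:ℝ), ∀ j, tau p lam t ^ 2 * X t j =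
    (1 - 2 * p j) * t ^ (2 - 2 * p j) * (lam j : ℝ) * ν t
      - 4 * ∑ q, p q * t ^ (2 - 2 * p q) * (lam q : ℝ) * η t q j
      + 2 * t ^ (2 - 2 * p j) * (lam j : ℝ) * ((∑ a, p a * η t a a) - 2 * pphi * φ t)
  cmc : ∀ t ∈ Set.Ioi (0:ℝ), ∑ a, κ t a a = 0
  sh_gauge : ∀ t ∈ Set.Ioi (0:ℝ), ∀ i,
    2 * ∑ j, (lam j : ℝ) * η t i j = (lam i : ℝ) * ∑ a, η t a a
  hamiltonian : ∀ t ∈ Set.Ioi (0:ℝ),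
    tau p lam t ^ 2 * (∑ a, η t a a) - 2 * (∑ a, p a * κ t a a) + 4 * pphi * ψ t = 0
  momentum : ∀ t ∈ Set.Ioi (0:ℝ), ∀ i,
    (∑ j, (lam j : ℝ) * κ t i j)
      + (lam i : ℝ) * (-(∑ a, p a * η t a a) + 2 * pphi * φ t)
      + p i * (lam i : ℝ) * (∑ a, η t a a) = 0
  sym_eta : ∀ t ∈ Set.Ioi (0:ℝ), ∀ a c,
    t ^ (-(2 * p a)) * η t a c = t ^ (-(2 * p c)) * η t c a
  sym_kappa : ∀ t ∈ Set.Ioi (0:ℝ), ∀ a c,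
    t ^ (-(2 * p a)) * (κ t a c + 2 * p a * η t a c)
      = t ^ (-(2 * p c)) * (κ t c a + 2 * p c * η t c a)

/-- The total high-frequency energy E_high = E_{η,high} + E_{φ,high} of a λ-mode solution. -/
noncomputable def EsysHigh {D : ℕ} (p : Fin D → ℝ) (lam : Fin D → ℤ)
    (η κ : ℝ → Fin D → Fin D → ℝ) (φ ψ : ℝ → ℝ) (t : ℝ) : ℝ :=
  (zeta p lam t ^ 2 / tau p lam t * (∑ i, ∑ j, κ t i j * κ t j i)
    + zeta p lam t / tau p lam t * (∑ i, ∑ j, κ t i j * η t j i)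
    + (1 / (2 * tau p lam t) + zeta p lam t ^ 2 * tau p lam t) * (∑ i, ∑ j, η t i j * η t j i))
  + (zeta p lam t ^ 2 / tau p lam t * ψ t ^ 2 + zeta p lam t / tau p lam t * ψ t * φ t
    + (1 / (2 * tau p lam t) + zeta p lam t ^ 2 * tau p lam t) * φ t ^ 2)

section Algebra

/-- The pointwise relations satisfied by a CMCSH mode when it is written in the orthonormal frame:
`h` is the metric perturbation, `s` the symmetrized second fundamental form, `x` the shift and
`l` the frame components of the frequency, of length `τ`. -/
structure IsFrameMode {D : ℕ} (p : Fin D → ℝ) (pphi : ℝ) (l : Fin D → ℝ)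
    (h s : Fin D → Fin D → ℝ) (x : Fin D → ℝ) (φ ψ ν τ : ℝ) : Prop where
  h_symm : ∀ i j, h i j = h j i
  s_symm : ∀ i j, s i j = s j i
  sum_sq : ∑ i, l i ^ 2 = τ ^ 2
  lapse : (1 + τ ^ 2) * ν = τ ^ 2 * ∑ a, h a a
  shift : ∀ j, τ ^ 2 * x j = (1 - 2 * p j) * l j * ν - 4 * ∑ q, p q * l q * h q j
    + 2 * l j * ((∑ a, p a * h a a) - 2 * pphi * φ)
  gauge : ∀ i, 2 * ∑ j, l j * h i j = l i * ∑ a, h a a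
  hamiltonian : τ ^ 2 * (∑ a, h a a) - 2 * (∑ a, p a * s a a) + 4 * pphi * ψ = 0
  momentum : ∀ i, (∑ j, l j * (s i j - (p i - p j) * h i j))
    + l i * (-(∑ a, p a * h a a) + 2 * pphi * φ) + p i * l i * (∑ a, h a a) = 0

/-- Inhomogeneity in the frame evolution equation of the metric perturbation. -/
noncomputable def metricSource {D : ℕ} (p l x : Fin D → ℝ) (ν : ℝ) (i j : Fin D) : ℝ :=
  -(p i * (if i = j then 1 else 0) * ν) - 1 / 2 * (l i * x j + l j * x i)

/-- Inhomogeneity, up to the term `l i * l j * ν`, in the frame evolution equation of the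
symmetrized second fundamental form. -/
noncomputable def curvatureSource {D : ℕ} (p l x : Fin D → ℝ) (ν : ℝ) (i j : Fin D) : ℝ :=
  p i * (if i = j then 1 else 0) * ν + (p i - p j) / 2 * (l i * x j - l j * x i)

lemma abs_sum_le_card_mul {D : ℕ} {f : Fin D → ℝ} {B : ℝ} (hf : ∀ i, |f i| ≤ B) :
    |∑ i, f i| ≤ D * B := by
  refine (Finset.abs_sum_le_sum_abs _ _).trans ?_
  simpa using Finset.sum_le_card_nsmul Finset.univ (fun i => |f i|) B (fun i _ => hf i)

lemma abs_mul_le_mul {a b A B : ℝ} (ha : |a| ≤ A) (hb : |b| ≤ B) : |a * b| ≤ A * B := by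
  rw [abs_mul]
  exact mul_le_mul ha hb (abs_nonneg _) ((abs_nonneg _).trans ha)

lemma abs_sum_sum_mul_le {D : ℕ} {f g : Fin D → Fin D → ℝ} {A B : ℝ}
    (hf : ∀ i j, |f i j| ≤ A) (hg : ∀ i j, |g i j| ≤ B) :
    |∑ i, ∑ j, f i j * g i j| ≤ D ^ 2 * (A * B) := by
  have := abs_sum_le_card_mul (f := fun i => ∑ j, f i j * g i j) (B := D * (A * B))
    fun i => abs_sum_le_card_mul fun j => abs_mul_le_mul (hf i j) (hg i j)
  linarith [this]

namespace IsFrameMode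

variable {D : ℕ} {p : Fin D → ℝ} {pphi : ℝ} {l : Fin D → ℝ} {h s : Fin D → Fin D → ℝ}
  {x : Fin D → ℝ} {φ ψ ν τ u : ℝ}

lemma abs_sub_le_two (hp : ∀ i, |p i| ≤ 1) (i j : Fin D) : |p i - p j| ≤ 2 :=
  (abs_sub _ _).trans (by linarith [hp i, hp j])

section bounds

variable (H : IsFrameMode p pphi l h s x φ ψ ν τ) (hD : 1 ≤ D) (hp : ∀ i, |p i| ≤ 1)
  (hpphi : |pphi| ≤ 1) (hτ : 1 ≤ τ) (hh : ∀ i j, |h i j| ≤ u) (hs : ∀ i j, |s i j| ≤ u * τ)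
  (hφ : |φ| ≤ u) (hψ : |ψ| ≤ u * τ)
include H

lemma abs_l_le (hτ : 1 ≤ τ) (i : Fin D) : |l i| ≤ τ := by
  refine abs_le_of_sq_le_sq ?_ (by linarith)
  rw [← H.sum_sq]
  exact Finset.single_le_sum (f := fun i => l i ^ 2) (fun _ _ => sq_nonneg _) (Finset.mem_univ i)

lemma abs_nu_le : |ν| ≤ |∑ a, h a a| := by
  have h1 : ν = τ ^ 2 / (1 + τ ^ 2) * ∑ a, h a a := by
    have := H.lapse
    have h2 : (1 + τ ^ 2) ≠ 0 := by positivity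
    field_simp
    linarith
  rw [h1, abs_mul, abs_of_nonneg (by positivity)]
  refine mul_le_of_le_one_left (abs_nonneg _) ?_
  rw [div_le_one (by positivity)]
  linarith

include hD hp hpphi hτ hs hψ in
lemma tau_mul_abs_trace_le : τ * |∑ a, h a a| ≤ 6 * D * u := by
  have hD' : (1 : ℝ) ≤ D := by exact_mod_cast hD
  have h1 : |∑ a, p a * s a a| ≤ D * (1 * (u * τ)) :=
    abs_sum_le_card_mul fun a => abs_mul_le_mul (hp a) (hs a a)
  have h2 : |pphi * ψ| ≤ 1 * (u * τ) := abs_mul_le_mul hpphi hψ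
  have h3 : τ ^ 2 * (∑ a, h a a) = 2 * (∑ a, p a * s a a) - 4 * (pphi * ψ) := by
    linarith [H.hamiltonian]
  have h4 : τ ^ 2 * |∑ a, h a a| ≤ 2 * (D * (1 * (u * τ))) + 4 * (1 * (u * τ)) := by
    rw [← abs_of_nonneg (sq_nonneg τ), ← abs_mul, h3]
    refine (abs_sub _ _).trans ?_
    rw [abs_mul, abs_mul 4, abs_two, abs_of_nonneg (by norm_num : (0 : ℝ) ≤ 4)]
    linarith
  have h5 : 0 ≤ u * τ := (abs_nonneg _).trans hψ
  have h6 : 0 ≤ (D - 1) * (u * τ) := mul_nonneg (by linarith) h5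
  refine le_of_mul_le_mul_left ?_ (by linarith : 0 < τ)
  nlinarith

include hD hp hpphi hτ hs hψ in
lemma abs_trace_le : |∑ a, h a a| ≤ 6 * D * u :=
  le_trans (le_mul_of_one_le_left (abs_nonneg _) hτ)
    (H.tau_mul_abs_trace_le hD hp hpphi hτ hs hψ)

include hD hp hpphi hτ hh hs hφ hψ in
lemma tau_mul_abs_x_le (j : Fin D) : τ * |x j| ≤ 28 * D * u := by
  have hD' : (1 : ℝ) ≤ D := by exact_mod_cast hD
  have hu : 0 ≤ u := (abs_nonneg _).trans hφ
  have hν : |ν| ≤ 6 * D * u := H.abs_nu_le.trans (H.abs_trace_le hD hp hpphi hτ hs hψ)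
  have hl := H.abs_l_le hτ
  have h0 : |1 - 2 * p j| ≤ 3 := by
    have := abs_le.1 (hp j)
    exact abs_le.2 ⟨by linarith, by linarith⟩
  have h1 : |(1 - 2 * p j) * l j * ν| ≤ 3 * τ * (6 * D * u) :=
    abs_mul_le_mul (abs_mul_le_mul h0 (hl j)) hν
  have h2 : |∑ q, p q * l q * h q j| ≤ D * (1 * τ * u) :=
    abs_sum_le_card_mul fun q => abs_mul_le_mul (abs_mul_le_mul (hp q) (hl q)) (hh q j)
  have h3 : |∑ a, p a * h a a| ≤ D * (1 * u) :=
    abs_sum_le_card_mul fun a => abs_mul_le_mul (hp a) (hh a a)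
  have h4 : |pphi * φ| ≤ 1 * u := abs_mul_le_mul hpphi hφ
  have h5 : |(∑ a, p a * h a a) - 2 * pphi * φ| ≤ D * (1 * u) + 2 * (1 * u) := by
    rw [abs_le] at *
    constructor <;> linarith
  have h6 : |l j * ((∑ a, p a * h a a) - 2 * pphi * φ)| ≤ τ * (D * (1 * u) + 2 * (1 * u)) :=
    abs_mul_le_mul (hl j) h5
  have h7 : τ * (τ * |x j|) ≤
      3 * τ * (6 * D * u) + 4 * (D * (1 * τ * u)) + 2 * (τ * (D * (1 * u) + 2 * (1 * u))) := by
    have : τ * (τ * |x j|) = |τ ^ 2 * x j| := by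
      rw [abs_mul, abs_of_nonneg (sq_nonneg τ)]; ring
    rw [this, H.shift j]
    rw [abs_le] at h1 h2 h6 ⊢
    constructor <;> linarith
  refine le_of_mul_le_mul_left (h7.trans ?_) (by linarith : 0 < τ)
  have : 0 ≤ τ * ((D - 1) * u) := mul_nonneg (by linarith) (mul_nonneg (by linarith) hu)
  nlinarith

include hD hp hpphi hτ hh hs hφ hψ in
lemma abs_l_mul_x_le (i j : Fin D) : |l i * x j| ≤ 28 * D * u := by
  rw [abs_mul]
  exact (mul_le_mul_of_nonneg_right (H.abs_l_le hτ i) (abs_nonneg _)).trans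
    (H.tau_mul_abs_x_le hD hp hpphi hτ hh hs hφ hψ j)

include hD hp hpphi hτ hs hψ in
lemma abs_diagonal_le (i j : Fin D) :
    |p i * (if i = j then 1 else 0) * ν| ≤ 6 * D * u := by
  have h1 : |(if i = j then 1 else 0 : ℝ)| ≤ 1 := by split_ifs <;> simp
  have := abs_mul_le_mul (abs_mul_le_mul (hp i) h1)
    (H.abs_nu_le.trans (H.abs_trace_le hD hp hpphi hτ hs hψ))
  linarith

include hD hp hpphi hτ hh hs hφ hψ in
lemma abs_metricSource_le (i j : Fin D) : |metricSource p l x ν i j| ≤ 34 * D * u := by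
  have h1 := H.abs_diagonal_le hD hp hpphi hτ hs hψ i j
  have h2 := H.abs_l_mul_x_le hD hp hpphi hτ hh hs hφ hψ i j
  have h3 := H.abs_l_mul_x_le hD hp hpphi hτ hh hs hφ hψ j i
  unfold metricSource
  rw [abs_le] at *
  constructor <;> linarith

include hD hp hpphi hτ hh hs hφ hψ in
lemma abs_curvatureSource_le (i j : Fin D) : |curvatureSource p l x ν i j| ≤ 62 * D * u := by
  have h1 := H.abs_diagonal_le hD hp hpphi hτ hs hψ i j
  have h2 := H.abs_l_mul_x_le hD hp hpphi hτ hh hs hφ hψ i j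
  have h3 := H.abs_l_mul_x_le hD hp hpphi hτ hh hs hφ hψ j i
  have h4 : |l i * x j - l j * x i| ≤ 56 * D * u := by
    rw [abs_le] at *
    constructor <;> linarith
  have h5 : |(p i - p j) / 2| ≤ 1 := by
    rw [abs_div, abs_two]
    linarith [abs_sub_le_two hp i j]
  have h6 := abs_mul_le_mul h5 h4
  unfold curvatureSource
  rw [abs_le] at h1 h6 ⊢
  constructor <;> linarith

include hD hp hpphi hτ hh hs hφ hψ in
lemma abs_sum_l_mul_s_le (i : Fin D) : |∑ j, l j * s i j| ≤ 11 * D * u * τ := by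
  have hD' : (1 : ℝ) ≤ D := by exact_mod_cast hD
  have hu : 0 ≤ u := (abs_nonneg _).trans hφ
  have hl := H.abs_l_le hτ
  have h1 : |∑ j, l j * ((p i - p j) * h i j)| ≤ D * (τ * (2 * u)) :=
    abs_sum_le_card_mul fun j =>
      abs_mul_le_mul (hl j) (abs_mul_le_mul (abs_sub_le_two hp i j) (hh i j))
  have h3 : |∑ a, p a * h a a| ≤ D * (1 * u) :=
    abs_sum_le_card_mul fun a => abs_mul_le_mul (hp a) (hh a a)
  have h4 : |pphi * φ| ≤ 1 * u := abs_mul_le_mul hpphi hφ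
  have h5 : |-(∑ a, p a * h a a) + 2 * pphi * φ| ≤ D * (1 * u) + 2 * (1 * u) := by
    rw [abs_le] at *
    constructor <;> linarith
  have h6 := abs_mul_le_mul (hl i) h5
  have h7 := abs_mul_le_mul (abs_mul_le_mul (hp i) (hl i)) (H.abs_trace_le hD hp hpphi hτ hs hψ)
  have h8 : ∑ j, l j * s i j = ∑ j, l j * ((p i - p j) * h i j)
      - l i * (-(∑ a, p a * h a a) + 2 * pphi * φ) - p i * l i * (∑ a, h a a) := by
    have h9 := H.momentum i
    simp only [mul_sub (l _), Finset.sum_sub_distrib] at h9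
    linarith
  have h9 : 0 ≤ τ * ((D - 1) * u) := mul_nonneg (by linarith) (mul_nonneg (by linarith) hu)
  rw [h8]
  rw [abs_le] at h1 h6 h7 ⊢
  constructor <;> nlinarith

include hD hp hpphi hτ hh hs hφ hψ in
lemma abs_curvature_error_le :
    |(∑ i, ∑ j, s i j * (l i * l j * ν + curvatureSource p l x ν i j)) + ψ * (-(pphi * ν))|
      ≤ 134 * D ^ 3 * u ^ 2 * τ := by
  have hD' : (1 : ℝ) ≤ D := by exact_mod_cast hD
  have hu : 0 ≤ u := (abs_nonneg _).trans hφ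
  have hν : |ν| ≤ 6 * D * u := H.abs_nu_le.trans (H.abs_trace_le hD hp hpphi hτ hs hψ)
  have hτν : |τ * ν| ≤ 6 * D * u := by
    rw [abs_mul, abs_of_nonneg (by linarith)]
    exact (mul_le_mul_of_nonneg_left H.abs_nu_le (by linarith)).trans
      (H.tau_mul_abs_trace_le hD hp hpphi hτ hs hψ)
  have h1 := abs_sum_sum_mul_le hs (H.abs_curvatureSource_le hD hp hpphi hτ hh hs hφ hψ)
  have h2 := abs_mul_le_mul hψ (abs_mul_le_mul hpphi hν)
  have h3 : |∑ i, l i * (∑ j, l j * s i j)| ≤ D * (τ * (11 * D * u * τ)) :=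
    abs_sum_le_card_mul fun i => abs_mul_le_mul (H.abs_l_le hτ i)
      (H.abs_sum_l_mul_s_le hD hp hpphi hτ hh hs hφ hψ i)
  have h4 : |ν * ∑ i, l i * (∑ j, l j * s i j)| ≤ 66 * D ^ 3 * u ^ 2 * τ := by
    have := abs_mul_le_mul hτν h3
    refine le_of_mul_le_mul_left ?_ (by linarith : 0 < τ)
    rw [← abs_of_nonneg (by linarith : 0 ≤ τ), ← abs_mul, abs_of_nonneg (by linarith : 0 ≤ τ),
      ← mul_assoc]
    linarith
  have h5 : (∑ i, ∑ j, s i j * (l i * l j * ν + curvatureSource p l x ν i j))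
      = ν * (∑ i, l i * (∑ j, l j * s i j)) + ∑ i, ∑ j, s i j * curvatureSource p l x ν i j := by
    simp only [Finset.mul_sum, ← Finset.sum_add_distrib]
    exact Finset.sum_congr rfl fun i _ => Finset.sum_congr rfl fun j _ => by ring
  have h6 : (D : ℝ) ≤ D ^ 3 := le_self_pow₀ hD' (by norm_num)
  have h7 := mul_le_mul_of_nonneg_right h6 (by positivity : 0 ≤ u ^ 2 * τ)
  rw [h5]
  rw [abs_le] at h1 h2 h4 ⊢
  constructor <;> nlinarith

include hD hp hpphi hτ hh hs hφ hψ in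
lemma abs_mixed_error_le :
    |(∑ i, ∑ j, s i j * metricSource p l x ν i j)
      + (∑ i, ∑ j, h i j * (l i * l j * ν + curvatureSource p l x ν i j))
      + pphi * ν * ψ + φ * (-(pphi * ν))| ≤ 126 * D ^ 3 * u ^ 2 * τ := by
  have hD' : (1 : ℝ) ≤ D := by exact_mod_cast hD
  have hu : 0 ≤ u := (abs_nonneg _).trans hφ
  have hν : |ν| ≤ 6 * D * u := H.abs_nu_le.trans (H.abs_trace_le hD hp hpphi hτ hs hψ)
  have hτT : |τ * ∑ a, h a a| ≤ 6 * D * u := by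
    rw [abs_mul, abs_of_nonneg (by linarith)]
    exact H.tau_mul_abs_trace_le hD hp hpphi hτ hs hψ
  have hτν : |τ * ν| ≤ 6 * D * u := by
    rw [abs_mul, abs_of_nonneg (by linarith)]
    exact (mul_le_mul_of_nonneg_left H.abs_nu_le (by linarith)).trans
      (H.tau_mul_abs_trace_le hD hp hpphi hτ hs hψ)
  have h1 := abs_sum_sum_mul_le hh (H.abs_curvatureSource_le hD hp hpphi hτ hh hs hφ hψ)
  have h2 := abs_mul_le_mul (abs_mul_le_mul hpphi hν) hψ
  have h2' := abs_mul_le_mul hφ (abs_mul_le_mul hpphi hν)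
  have h3 := abs_sum_sum_mul_le hs (H.abs_metricSource_le hD hp hpphi hτ hh hs hφ hψ)
  have h4 := abs_mul_le_mul hτν hτT
  have h5 : (∑ i, ∑ j, h i j * (l i * l j * ν + curvatureSource p l x ν i j))
      = 1 / 2 * (τ * ν * (τ * ∑ a, h a a))
        + ∑ i, ∑ j, h i j * curvatureSource p l x ν i j := by
    have h6 : τ ^ 2 * (∑ a, h a a) = 2 * ∑ i, ∑ j, h i j * (l i * l j) := by
      rw [← H.sum_sq, Finset.sum_mul, Finset.mul_sum]
      refine Finset.sum_congr rfl fun i _ => ?_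
      rw [pow_two, mul_assoc, ← H.gauge i, Finset.mul_sum, Finset.mul_sum, Finset.mul_sum]
      exact Finset.sum_congr rfl fun j _ => by ring
    have h7 : 1 / 2 * (τ * ν * (τ * ∑ a, h a a)) = ν * ∑ i, ∑ j, h i j * (l i * l j) := by
      linear_combination ν / 2 * h6
    rw [h7]
    simp only [Finset.mul_sum, ← Finset.sum_add_distrib]
    exact Finset.sum_congr rfl fun i _ => Finset.sum_congr rfl fun j _ => by ring
  have h6 : (D : ℝ) ≤ D ^ 3 := le_self_pow₀ hD' (by norm_num)
  have h6' : (D : ℝ) ^ 2 ≤ D ^ 3 := pow_le_pow_right₀ hD' (by norm_num)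
  have h7 := mul_le_mul_of_nonneg_right h6 (by positivity : 0 ≤ u ^ 2 * τ)
  have h7' := mul_le_mul_of_nonneg_right h6' (by positivity : 0 ≤ u ^ 2 * τ)
  have h8 : (D : ℝ) * u ^ 2 * 1 ≤ D * u ^ 2 * τ := mul_le_mul_of_nonneg_left hτ (by positivity)
  have h8' : (D : ℝ) ^ 2 * u ^ 2 * 1 ≤ D ^ 2 * u ^ 2 * τ :=
    mul_le_mul_of_nonneg_left hτ (by positivity)
  have h8'' : (D : ℝ) ^ 3 * u ^ 2 * 1 ≤ D ^ 3 * u ^ 2 * τ :=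
    mul_le_mul_of_nonneg_left hτ (by positivity)
  rw [h5]
  rw [abs_le] at h1 h2 h2' h3 h4 ⊢
  constructor <;> nlinarith

include hD hp hpphi hτ hh hs hφ hψ in
lemma tau_mul_abs_metric_error_le :
    τ * |(∑ i, ∑ j, h i j * metricSource p l x ν i j) + φ * (pphi * ν)|
      ≤ 96 * D ^ 3 * u ^ 2 := by
  have hD' : (1 : ℝ) ≤ D := by exact_mod_cast hD
  have hu : 0 ≤ u := (abs_nonneg _).trans hφ
  have hτT : |τ * ∑ a, h a a| ≤ 6 * D * u := by
    rw [abs_mul, abs_of_nonneg (by linarith)]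
    exact H.tau_mul_abs_trace_le hD hp hpphi hτ hs hψ
  have hτν : |τ * ν| ≤ 6 * D * u := by
    rw [abs_mul, abs_of_nonneg (by linarith)]
    exact (mul_le_mul_of_nonneg_left H.abs_nu_le (by linarith)).trans
      (H.tau_mul_abs_trace_le hD hp hpphi hτ hs hψ)
  have h3 : |∑ a, p a * h a a| ≤ D * (1 * u) :=
    abs_sum_le_card_mul fun a => abs_mul_le_mul (hp a) (hh a a)
  have h4 : |∑ i, l i * x i| ≤ D * (28 * D * u) :=
    abs_sum_le_card_mul fun i => H.abs_l_mul_x_le hD hp hpphi hτ hh hs hφ hψ i i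
  have h5 := abs_mul_le_mul hτν h3
  have h6 := abs_mul_le_mul hτT h4
  have h7 := abs_mul_le_mul hτν (abs_mul_le_mul hpphi hφ)
  have hswap : ∑ i, ∑ j, h i j * (l j * x i) = ∑ i, ∑ j, h i j * (l i * x j) := by
    rw [Finset.sum_comm]
    exact Finset.sum_congr rfl fun i _ => Finset.sum_congr rfl fun j _ => by rw [H.h_symm]
  have hlx : 2 * ∑ i, ∑ j, h i j * (l j * x i) = (∑ a, h a a) * ∑ i, l i * x i := by
    rw [Finset.mul_sum, Finset.mul_sum]
    refine Finset.sum_congr rfl fun i _ => ?_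
    have := H.gauge i
    calc 2 * ∑ j, h i j * (l j * x i) = (2 * ∑ j, l j * h i j) * x i := by
          rw [mul_assoc, Finset.sum_mul]
          congr 1
          exact Finset.sum_congr rfl fun j _ => by ring
      _ = _ := by rw [this]; ring
  have hdiag : ∑ i, ∑ j, h i j * (p i * (if i = j then 1 else 0) * ν)
      = ν * ∑ a, p a * h a a := by
    rw [Finset.mul_sum]
    refine Finset.sum_congr rfl fun i _ => ?_
    rw [Finset.sum_eq_single i (fun j _ hj => by simp [Ne.symm hj]) (by simp)]
    simp
    ring
  have h8 : ∑ i, ∑ j, h i j * metricSource p l x ν i j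
      = -(ν * ∑ a, p a * h a a) - 1 / 2 * ((∑ a, h a a) * ∑ i, l i * x i) := by
    rw [← hlx, ← hdiag]
    have : ∀ i j, h i j * metricSource p l x ν i j
        = -(h i j * (p i * (if i = j then 1 else 0) * ν))
          - 1 / 2 * (h i j * (l i * x j) + h i j * (l j * x i)) := by
      intro i j
      unfold metricSource
      ring
    simp only [this, Finset.sum_sub_distrib, Finset.sum_neg_distrib, ← Finset.mul_sum,
      Finset.sum_add_distrib]
    rw [← hswap]
    ring
  have h9 : (D : ℝ) ≤ D ^ 3 := le_self_pow₀ hD' (by norm_num)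
  have h9' : (D : ℝ) ^ 2 ≤ D ^ 3 := pow_le_pow_right₀ hD' (by norm_num)
  have h10 := mul_le_mul_of_nonneg_right h9 (by positivity : 0 ≤ u ^ 2)
  have h10' := mul_le_mul_of_nonneg_right h9' (by positivity : 0 ≤ u ^ 2)
  rw [h8, ← abs_of_nonneg (by linarith : 0 ≤ τ), ← abs_mul]
  rw [abs_le] at h5 h6 h7 ⊢
  constructor <;> nlinarith

include hD hp hpphi hτ hh hs hφ hψ in
lemma abs_commutator_error_le :
    |∑ i, ∑ j, (p i - p j) ^ 2 * h i j * metricSource p l x ν i j| ≤ 136 * D ^ 3 * u ^ 2 := by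
  have h1 : ∀ i j, |(p i - p j) ^ 2 * h i j| ≤ 4 * u := fun i j => by
    have := abs_mul_le_mul (abs_sub_le_two hp i j) (abs_sub_le_two hp i j)
    exact abs_mul_le_mul (by rw [pow_two]; linarith) (hh i j)
  have := abs_sum_sum_mul_le h1 (H.abs_metricSource_le hD hp hpphi hτ hh hs hφ hψ)
  linarith

end bounds

end IsFrameMode
end Algebra

section ScalarEstimates

lemma high_energy_coercive {A B C M τ ζ : ℝ} (hτ : 3 ≤ τ) (hA : 0 ≤ A) (hC : 0 ≤ C)
    (hM : M ≤ 4 * C) (hζ : 1 / 2 ≤ ζ) (hq : ∀ z, 0 ≤ z ^ 2 * A + 2 * z * B + C) :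
    (A + τ ^ 2 * C) / 8 ≤ ζ ^ 2 * A + ζ * B + 1 / 2 * C + ζ ^ 2 * (τ ^ 2 * C - M) := by
  have h1 := hq ζ
  have h2 : 1 / 4 ≤ ζ ^ 2 := by nlinarith
  have h3 : 9 * C ≤ τ ^ 2 * C := mul_le_mul_of_nonneg_right (by nlinarith) hC
  have h4 : 0 ≤ (ζ ^ 2 - 1 / 4) * (A + τ ^ 2 * C) := mul_nonneg (by linarith) (by linarith)
  have h5 : 0 ≤ ζ ^ 2 * (τ ^ 2 * C - M - 1 / 2 * (τ ^ 2 * C)) :=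
    mul_nonneg (by positivity) (by linarith)
  nlinarith

lemma high_energy_rate_le {A B C M τ ζ K c u z RA RB RC RM : ℝ} (hτ : 3 ≤ τ)
    (hA : 0 ≤ A) (hC : 0 ≤ C) (hM0 : 0 ≤ M) (hM : M ≤ 4 * C) (hζ : 1 / 2 ≤ ζ) (hζK : ζ ≤ K)
    (hK : 1 ≤ K) (hc : 1 ≤ c) (hq : ∀ z, 0 ≤ z ^ 2 * A + 2 * z * B + C)
    (hu : u ^ 2 * τ ^ 2 = A + τ ^ 2 * C)
    (hRA : |RA| ≤ 134 * c * u ^ 2 * τ) (hRB : |RB| ≤ 126 * c * u ^ 2 * τ)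
    (hRC : τ * |RC| ≤ 96 * c * u ^ 2) (hRM : |RM| ≤ 136 * c * u ^ 2) :
    |z * (2 * ζ * A + B + 2 * ζ * (τ ^ 2 * C - M)) + 2 * ζ * M - C / (2 * ζ)
        + 2 * ζ ^ 2 * RA + ζ * RB + RC + 2 * ζ ^ 2 * τ ^ 2 * RC - 2 * ζ ^ 2 * RM|
      ≤ 8000 * K ^ 2 * c * (|z| + τ⁻¹)
        * (ζ ^ 2 * A + ζ * B + 1 / 2 * C + ζ ^ 2 * (τ ^ 2 * C - M)) := by
  have hco := high_energy_coercive hτ hA hC hM hζ hq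
  set Q := ζ ^ 2 * A + ζ * B + 1 / 2 * C + ζ ^ 2 * (τ ^ 2 * C - M) with hQ
  have hτ2 : 9 * C ≤ τ ^ 2 * C := mul_le_mul_of_nonneg_right (by nlinarith) hC
  have hN : 0 ≤ A + τ ^ 2 * C := by positivity
  have hCu : C ≤ u ^ 2 := by
    refine le_of_mul_le_mul_right (a := τ ^ 2) ?_ (by positivity)
    nlinarith
  have hK2 : 1 ≤ K ^ 2 := one_le_pow₀ hK
  have hKK : K ≤ K ^ 2 := by nlinarith
  have hζ2 : ζ ^ 2 ≤ K ^ 2 := by gcongr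
  have hB : |B| ≤ A + C := by
    have h1 := hq 1
    have h2 := hq (-1)
    rw [abs_le]
    constructor <;> linarith
  have hζ0 : |ζ| ≤ K ^ 2 := by rw [abs_of_nonneg (by linarith)]; linarith
  have hζ20 : |2 * ζ ^ 2| ≤ 2 * K ^ 2 := by rw [abs_of_nonneg (by positivity)]; linarith
  have hprin : |2 * ζ * A + B + 2 * ζ * (τ ^ 2 * C - M)| ≤ 3 * K ^ 2 * (A + τ ^ 2 * C) := by
    have h1 : |2 * ζ * (A + (τ ^ 2 * C - M))| ≤ 2 * K ^ 2 * (A + τ ^ 2 * C) := by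
      rw [abs_of_nonneg (mul_nonneg (by linarith) (by linarith))]
      exact mul_le_mul (by linarith) (by linarith) (by linarith) (by positivity)
    have h2 : A + C ≤ K ^ 2 * (A + τ ^ 2 * C) := by nlinarith
    rw [abs_le] at h1 hB ⊢
    constructor <;> linarith
  have h1 := abs_mul_le_mul (le_refl |z|) hprin
  have h2 := abs_mul_le_mul hζ20 hRA
  have h3 := abs_mul_le_mul hζ0 hRB
  have hRC' : |τ ^ 2 * RC| ≤ 96 * c * u ^ 2 * τ := by
    rw [abs_mul, abs_of_nonneg (sq_nonneg τ)]
    nlinarith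
  have h4 := abs_mul_le_mul hζ20 hRC'
  have h5 := abs_mul_le_mul hζ20 hRM
  have hcu : 0 ≤ c * u ^ 2 := by positivity
  have hKcu : c * u ^ 2 ≤ K ^ 2 * (c * u ^ 2) := le_mul_of_one_le_left hcu hK2
  have hRC1 : |RC| ≤ 96 * (K ^ 2 * (c * u ^ 2)) := by
    have : |RC| ≤ τ * |RC| := le_mul_of_one_le_left (abs_nonneg _) (by linarith)
    linarith
  have hucu : u ^ 2 ≤ c * u ^ 2 := le_mul_of_one_le_left (sq_nonneg u) hc
  have hM1 : |2 * ζ * M| ≤ 8 * (K ^ 2 * (c * u ^ 2)) := by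
    rw [abs_of_nonneg (by positivity)]
    have : ζ * M ≤ K ^ 2 * (4 * (c * u ^ 2)) :=
      mul_le_mul (by linarith) (by linarith) hM0 (by positivity)
    linarith
  have hC1 : |C / (2 * ζ)| ≤ K ^ 2 * (c * u ^ 2) := by
    rw [abs_of_nonneg (by positivity)]
    exact (div_le_self hC (by linarith)).trans (by linarith)
  have hKτ : K ^ 2 * (c * u ^ 2) ≤ K ^ 2 * (c * u ^ 2) * τ :=
    le_mul_of_one_le_right (by positivity) (by linarith)
  have hsum : |z * (2 * ζ * A + B + 2 * ζ * (τ ^ 2 * C - M)) + 2 * ζ * M - C / (2 * ζ)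
        + 2 * ζ ^ 2 * RA + ζ * RB + RC + 2 * ζ ^ 2 * τ ^ 2 * RC - 2 * ζ ^ 2 * RM|
      ≤ |z| * (3 * K ^ 2 * (A + τ ^ 2 * C)) + 1000 * (K ^ 2 * (c * u ^ 2) * τ) := by
    rw [abs_le] at h1 h2 h3 h4 h5 hRC1 hM1 hC1 ⊢
    constructor <;> linarith
  have huτ : c * u ^ 2 * τ = c * (A + τ ^ 2 * C) * τ⁻¹ := by
    rw [← hu]
    field_simp
  have hfin : K ^ 2 * (c * u ^ 2) * τ = K ^ 2 * c * τ⁻¹ * (A + τ ^ 2 * C) := by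
    linear_combination K ^ 2 * huτ
  rw [hfin] at hsum
  refine hsum.trans ?_
  have h6 : |z| * (3 * K ^ 2 * (A + τ ^ 2 * C))
      ≤ 1000 * (K ^ 2 * c * |z| * (A + τ ^ 2 * C)) := by
    have h7 : 0 ≤ K ^ 2 * |z| * (A + τ ^ 2 * C) := by positivity
    have := mul_le_mul_of_nonneg_right hc h7
    linarith
  have h7 := mul_le_mul_of_nonneg_left hco
    (by positivity : 0 ≤ 8000 * K ^ 2 * c * (|z| + τ⁻¹))
  linarith

end ScalarEstimates

namespace IsFrameMode

lemma energy_rate_le {D : ℕ} {p : Fin D → ℝ} {pphi : ℝ} {l : Fin D → ℝ}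
    {h s : Fin D → Fin D → ℝ} {x : Fin D → ℝ} {φ ψ ν τ ζ K z : ℝ}
    (H : IsFrameMode p pphi l h s x φ ψ ν τ) (hD : 1 ≤ D) (hp : ∀ i, |p i| ≤ 1)
    (hpphi : |pphi| ≤ 1) (hτ : 3 ≤ τ) (hζ : 1 / 2 ≤ ζ) (hζK : ζ ≤ K) (hK : 1 ≤ K)
    {A B C M RA RB RC RM : ℝ}
    (hA : A = ∑ i, ∑ j, s i j ^ 2 + ψ ^ 2) (hB : B = ∑ i, ∑ j, s i j * h i j + ψ * φ)
    (hC : C = ∑ i, ∑ j, h i j ^ 2 + φ ^ 2) (hM : M = ∑ i, ∑ j, (p i - p j) ^ 2 * h i j ^ 2)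
    (hRA : RA = (∑ i, ∑ j, s i j * (l i * l j * ν + curvatureSource p l x ν i j))
      + ψ * (-(pphi * ν)))
    (hRB : RB = (∑ i, ∑ j, s i j * metricSource p l x ν i j)
      + (∑ i, ∑ j, h i j * (l i * l j * ν + curvatureSource p l x ν i j))
      + pphi * ν * ψ + φ * (-(pphi * ν)))
    (hRC : RC = (∑ i, ∑ j, h i j * metricSource p l x ν i j) + φ * (pphi * ν))
    (hRM : RM = ∑ i, ∑ j, (p i - p j) ^ 2 * h i j * metricSource p l x ν i j) :
    0 ≤ ζ ^ 2 * A + ζ * B + 1 / 2 * C + ζ ^ 2 * (τ ^ 2 * C - M) ∧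
    |z * (2 * ζ * A + B + 2 * ζ * (τ ^ 2 * C - M)) + 2 * ζ * M - C / (2 * ζ)
        + 2 * ζ ^ 2 * RA + ζ * RB + RC + 2 * ζ ^ 2 * τ ^ 2 * RC - 2 * ζ ^ 2 * RM|
      ≤ 8000 * K ^ 2 * (D : ℝ) ^ 3 * (|z| + τ⁻¹)
        * (ζ ^ 2 * A + ζ * B + 1 / 2 * C + ζ ^ 2 * (τ ^ 2 * C - M)) := by
  have hD' : (1 : ℝ) ≤ D := by exact_mod_cast hD
  have hA0 : 0 ≤ A := by rw [hA]; positivity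
  have hC0 : 0 ≤ C := by rw [hC]; positivity
  have hM0 : 0 ≤ M := by rw [hM]; positivity
  have hM4 : M ≤ 4 * C := by
    rw [hM, hC, mul_add, Finset.mul_sum]
    refine le_add_of_le_of_nonneg (Finset.sum_le_sum fun i _ => ?_) (by positivity)
    rw [Finset.mul_sum]
    refine Finset.sum_le_sum fun j _ => mul_le_mul_of_nonneg_right ?_ (sq_nonneg _)
    have := abs_le.1 (abs_sub_le_two hp i j)
    nlinarith
  have hq : ∀ z, 0 ≤ z ^ 2 * A + 2 * z * B + C := fun z => by
    have h1 : z ^ 2 * A + 2 * z * B + C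
        = (∑ i, ∑ j, (z * s i j + h i j) ^ 2) + (z * ψ + φ) ^ 2 := by
      have h2 : ∀ i j, (z * s i j + h i j) ^ 2
          = z ^ 2 * s i j ^ 2 + 2 * z * (s i j * h i j) + h i j ^ 2 := fun i j => by ring
      simp only [h2, Finset.sum_add_distrib, ← Finset.mul_sum]
      rw [hA, hB, hC]
      ring
    rw [h1]
    positivity
  have hτ0 : 0 < τ := by linarith
  have hN : 0 ≤ A + τ ^ 2 * C := by positivity
  refine ⟨le_trans (by positivity) (high_energy_coercive hτ hA0 hC0 hM4 hζ hq), ?_⟩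
  set u := √(A + τ ^ 2 * C) / τ with hu_def
  have hu0 : 0 ≤ u := by positivity
  have hu : u ^ 2 * τ ^ 2 = A + τ ^ 2 * C := by
    rw [hu_def, div_pow, Real.sq_sqrt hN]
    field_simp
  have hCle : C ≤ u ^ 2 := by
    refine le_of_mul_le_mul_right (a := τ ^ 2) ?_ (by positivity)
    linarith
  have hAle : A ≤ (u * τ) ^ 2 := by
    rw [mul_pow, hu]
    linarith [mul_nonneg (sq_nonneg τ) hC0]
  have entry : ∀ (f : Fin D → Fin D → ℝ) i j, f i j ^ 2 ≤ ∑ i, ∑ j, f i j ^ 2 := fun f i j =>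
    (Finset.single_le_sum (f := fun j => f i j ^ 2) (fun _ _ => sq_nonneg _)
      (Finset.mem_univ j)).trans
    (Finset.single_le_sum (f := fun i => ∑ j, f i j ^ 2) (fun _ _ => by positivity)
      (Finset.mem_univ i))
  have hsumh : 0 ≤ ∑ i, ∑ j, h i j ^ 2 := by positivity
  have hsums : 0 ≤ ∑ i, ∑ j, s i j ^ 2 := by positivity
  have hh : ∀ i j, |h i j| ≤ u := fun i j =>
    abs_le_of_sq_le_sq (by linarith [entry h i j, sq_nonneg φ]) hu0
  have hs : ∀ i j, |s i j| ≤ u * τ := fun i j =>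
    abs_le_of_sq_le_sq (by linarith [entry s i j, sq_nonneg ψ]) (by positivity)
  have hφ : |φ| ≤ u := abs_le_of_sq_le_sq (by linarith) hu0
  have hψ : |ψ| ≤ u * τ := abs_le_of_sq_le_sq (by linarith) (by positivity)
  have hτ1 : 1 ≤ τ := by linarith
  subst hRA hRB hRC hRM
  exact high_energy_rate_le hτ hA0 hC0 hM0 hM4 hζ hζK hK (one_le_pow₀ hD') hq hu
    (H.abs_curvature_error_le hD hp hpphi hτ1 hh hs hφ hψ)
    (H.abs_mixed_error_le hD hp hpphi hτ1 hh hs hφ hψ)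
    (H.tau_mul_abs_metric_error_le hD hp hpphi hτ1 hh hs hφ hψ)
    (H.abs_commutator_error_le hD hp hpphi hτ1 hh hs hφ hψ)

end IsFrameMode

section Coefficients

variable {D : ℕ} {p : Fin D → ℝ} {lam : Fin D → ℤ} {t : ℝ}

lemma tau_sq (ht : 0 < t) :
    tau p lam t ^ 2 = ∑ i, t ^ (2 - 2 * p i) * ((lam i : ℝ)) ^ 2 :=
  Real.sq_sqrt (by positivity)

lemma tau_pos (hlam : lam ≠ 0) (ht : 0 < t) : 0 < tau p lam t := by
  obtain ⟨i, hi⟩ := Function.ne_iff.1 hlam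
  have hi' : (lam i : ℝ) ≠ 0 := by exact_mod_cast hi
  exact Real.sqrt_pos.2 (Finset.sum_pos' (fun _ _ => by positivity)
    ⟨i, Finset.mem_univ i, by positivity⟩)

lemma weighted_sum_bounds {K : ℝ} (hp : ∀ i, |p i| ≤ 1) (hK : ∀ i, 1 ≤ K * (1 - p i))
    (ht : 0 < t) :
    ∑ i, (2 - 2 * p i) * t ^ (2 - 2 * p i) * ((lam i : ℝ)) ^ 2 ≤ 4 * tau p lam t ^ 2 ∧
    2 * tau p lam t ^ 2 ≤ K * ∑ i, (2 - 2 * p i) * t ^ (2 - 2 * p i) * ((lam i : ℝ)) ^ 2 := by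
  rw [tau_sq ht, Finset.mul_sum, Finset.mul_sum, Finset.mul_sum]
  have hw : ∀ i, 0 ≤ t ^ (2 - 2 * p i) * ((lam i : ℝ)) ^ 2 := fun i => by positivity
  constructor <;> refine Finset.sum_le_sum fun i _ => ?_
  · have := (abs_le.1 (hp i)).1
    nlinarith [hw i]
  · nlinarith [mul_le_mul_of_nonneg_right (hK i) (hw i)]

lemma weighted_sum_pos {K : ℝ} (hp : ∀ i, |p i| ≤ 1) (hK : ∀ i, 1 ≤ K * (1 - p i))
    (hlam : lam ≠ 0) (ht : 0 < t) :
    0 < ∑ i, (2 - 2 * p i) * t ^ (2 - 2 * p i) * ((lam i : ℝ)) ^ 2 := by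
  have h1 := (weighted_sum_bounds (lam := lam) hp hK ht).2
  have h2 : 0 ≤ ∑ i, (2 - 2 * p i) * t ^ (2 - 2 * p i) * ((lam i : ℝ)) ^ 2 :=
    Finset.sum_nonneg fun i _ => by
      have := (abs_le.1 (hp i)).2
      have : 0 ≤ 2 - 2 * p i := by linarith
      positivity
  refine h2.lt_of_ne fun h3 => ?_
  rw [← h3, mul_zero] at h1
  linarith [pow_pos (tau_pos (p := p) hlam ht) 2]

lemma half_le_zeta {K : ℝ} (hp : ∀ i, |p i| ≤ 1) (hK : ∀ i, 1 ≤ K * (1 - p i))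
    (hlam : lam ≠ 0) (ht : 0 < t) : 1 / 2 ≤ zeta p lam t := by
  rw [zeta, le_div_iff₀ (weighted_sum_pos hp hK hlam ht)]
  linarith [(weighted_sum_bounds (lam := lam) hp hK ht).1]

lemma zeta_le {K : ℝ} (hp : ∀ i, |p i| ≤ 1) (hK : ∀ i, 1 ≤ K * (1 - p i))
    (hlam : lam ≠ 0) (ht : 0 < t) : zeta p lam t ≤ K := by
  rw [zeta, div_le_iff₀ (weighted_sum_pos hp hK hlam ht)]
  exact (weighted_sum_bounds hp hK ht).2

lemma hasDerivAt_rpow_div (ht : 0 < t) (c : ℝ) :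
    HasDerivAt (fun s : ℝ => s ^ c) (c * t ^ c / t) t := by
  convert Real.hasDerivAt_rpow_const (p := c) (Or.inl ht.ne') using 1
  rw [Real.rpow_sub_one ht.ne']
  ring

lemma hasDerivAt_tau {K : ℝ} (hp : ∀ i, |p i| ≤ 1) (hK : ∀ i, 1 ≤ K * (1 - p i))
    (hlam : lam ≠ 0) (ht : 0 < t) :
    HasDerivAt (tau p lam) (tau p lam t / (zeta p lam t * t)) t := by
  have h1 : HasDerivAt (fun s => ∑ i, s ^ (2 - 2 * p i) * ((lam i : ℝ)) ^ 2)
      (∑ i, (2 - 2 * p i) * t ^ (2 - 2 * p i) / t * ((lam i : ℝ)) ^ 2) t :=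
    HasDerivAt.fun_sum fun i _ => (hasDerivAt_rpow_div ht _).mul_const _
  have hτ := tau_pos (p := p) hlam ht
  have hS := weighted_sum_pos hp hK hlam ht
  refine HasDerivAt.congr_deriv (f := tau p lam) (h1.sqrt (by rw [← tau_sq ht]; positivity)) ?_
  have h2 : ∑ i, (2 - 2 * p i) * t ^ (2 - 2 * p i) / t * ((lam i : ℝ)) ^ 2
      = (∑ i, (2 - 2 * p i) * t ^ (2 - 2 * p i) * ((lam i : ℝ)) ^ 2) / t := by
    rw [Finset.sum_div]
    exact Finset.sum_congr rfl fun i _ => by ring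
  rw [h2]
  change _ / (2 * tau p lam t) = _
  rw [zeta]
  field_simp

/-- The function `zeta` is differentiable and nonincreasing, the latter being an instance of the
Cauchy–Schwarz inequality. -/
lemma exists_hasDerivAt_zeta_nonpos {K : ℝ} (hp : ∀ i, |p i| ≤ 1)
    (hK : ∀ i, 1 ≤ K * (1 - p i)) (hlam : lam ≠ 0) (ht : 0 < t) :
    ∃ z, HasDerivAt (zeta p lam) z t ∧ z ≤ 0 := by
  set w : Fin D → ℝ := fun i => t ^ (2 - 2 * p i) * ((lam i : ℝ)) ^ 2 with hw
  have hS := weighted_sum_pos hp hK hlam ht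
  have h1 : HasDerivAt (fun s => ∑ i, (2 - 2 * p i) * s ^ (2 - 2 * p i) * ((lam i : ℝ)) ^ 2)
      (∑ i, (2 - 2 * p i) * ((2 - 2 * p i) * t ^ (2 - 2 * p i) / t) * ((lam i : ℝ)) ^ 2) t :=
    HasDerivAt.fun_sum fun i _ => ((hasDerivAt_rpow_div ht _).const_mul _).mul_const _
  have h2 := (((hasDerivAt_tau hp hK hlam ht).fun_pow 2).const_mul 2).fun_div h1 hS.ne'
  refine ⟨_, h2, div_nonpos_of_nonpos_of_nonneg ?_ (sq_nonneg _)⟩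
  have hτ := tau_pos (p := p) hlam ht
  have h3 : ∑ i, (2 - 2 * p i) * ((2 - 2 * p i) * t ^ (2 - 2 * p i) / t) * ((lam i : ℝ)) ^ 2
      = (∑ i, (2 - 2 * p i) ^ 2 * w i) / t := by
    rw [Finset.sum_div]
    exact Finset.sum_congr rfl fun i _ => by simp only [hw]; ring
  have h4 : ∑ i, (2 - 2 * p i) * t ^ (2 - 2 * p i) * ((lam i : ℝ)) ^ 2
      = ∑ i, (2 - 2 * p i) * w i :=
    Finset.sum_congr rfl fun i _ => by simp only [hw]; ring
  have hcs : (∑ i, (2 - 2 * p i) * w i) ^ 2 ≤ (∑ i, w i) * ∑ i, (2 - 2 * p i) ^ 2 * w i :=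
    Finset.sum_sq_le_sum_mul_sum_of_sq_le_mul _ (fun i _ => by positivity)
      (fun i _ => by positivity) (fun i _ => le_of_eq (by ring))
  have h5 : tau p lam t ^ 2 = ∑ i, w i := tau_sq ht
  rw [zeta, h3, h4]
  rw [h4] at hS
  rw [← h5] at hcs
  have h6 : 2 * (((2 : ℕ) : ℝ) * tau p lam t ^ (2 - 1) * (tau p lam t /
      (2 * tau p lam t ^ 2 / (∑ i, (2 - 2 * p i) * w i) * t))) * (∑ i, (2 - 2 * p i) * w i)
      - 2 * tau p lam t ^ 2 * ((∑ i, (2 - 2 * p i) ^ 2 * w i) / t)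
      = 2 * ((∑ i, (2 - 2 * p i) * w i) ^ 2
        - tau p lam t ^ 2 * ∑ i, (2 - 2 * p i) ^ 2 * w i) / t := by
    push_cast
    field_simp
  rw [h6]
  exact div_nonpos_of_nonpos_of_nonneg (by linarith) ht.le

end Coefficients

section Frame

variable {D : ℕ}

/-- Frame components of the metric perturbation. -/
noncomputable def frameMetric (p : Fin D → ℝ) (η : ℝ → Fin D → Fin D → ℝ) (t : ℝ)
    (i j : Fin D) : ℝ :=
  t ^ (p j - p i) * η t i j

/-- Symmetrized frame components of the second fundamental form. -/
noncomputable def frameCurvature (p : Fin D → ℝ) (η κ : ℝ → Fin D → Fin D → ℝ) (t : ℝ)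
    (i j : Fin D) : ℝ :=
  t ^ (p j - p i) * (κ t i j + (p i - p j) * η t i j)

/-- Frame components of the frequency. -/
noncomputable def frameFrequency (p : Fin D → ℝ) (lam : Fin D → ℤ) (t : ℝ) (i : Fin D) : ℝ :=
  t ^ (1 - p i) * lam i

/-- Frame components of the shift. -/
noncomputable def frameShift (p : Fin D → ℝ) (X : ℝ → Fin D → ℝ) (t : ℝ) (j : Fin D) : ℝ :=
  t ^ (p j - 1) * X t j

lemma rpow_two_sub {t : ℝ} (ht : 0 < t) (a : ℝ) : t ^ (2 - 2 * a) = t ^ 2 / (t ^ a) ^ 2 := by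
  rw [Real.rpow_sub ht, Real.rpow_two, mul_comm 2 a, Real.rpow_mul ht.le, Real.rpow_two]

lemma rpow_two_mul_sub {t : ℝ} (ht : 0 < t) (a b : ℝ) :
    t ^ (2 * a - 2 * b) = (t ^ a) ^ 2 / (t ^ b) ^ 2 := by
  rw [Real.rpow_sub ht, mul_comm 2 a, mul_comm 2 b, Real.rpow_mul ht.le, Real.rpow_mul ht.le,
    Real.rpow_two, Real.rpow_two]

lemma rpow_neg_two_mul {t : ℝ} (ht : 0 < t) (a : ℝ) : t ^ (-(2 * a)) = 1 / (t ^ a) ^ 2 := by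
  rw [Real.rpow_neg ht.le, mul_comm 2 a, Real.rpow_mul ht.le, Real.rpow_two, one_div]

namespace IsCMCSHSolution

variable {p : Fin D → ℝ} {pphi : ℝ} {lam : Fin D → ℤ} {η κ : ℝ → Fin D → Fin D → ℝ}
  {φ ψ ν : ℝ → ℝ} {X : ℝ → Fin D → ℝ} {t : ℝ}

lemma isFrameMode (H : IsCMCSHSolution p pphi lam η κ φ ψ ν X) (ht : 0 < t) :
    IsFrameMode p pphi (frameFrequency p lam t) (frameMetric p η t) (frameCurvature p η κ t)
      (frameShift p X t) (φ t) (ψ t) (ν t) (tau p lam t) := by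
  have hq : ∀ i, 0 < t ^ p i := fun i => by positivity
  have hm : ∀ i j, frameMetric p η t i j = t ^ p j / t ^ p i * η t i j := fun i j => by
    rw [frameMetric, Real.rpow_sub ht]
  have hk : ∀ i j, frameCurvature p η κ t i j
      = t ^ p j / t ^ p i * (κ t i j + (p i - p j) * η t i j) := fun i j => by
    rw [frameCurvature, Real.rpow_sub ht]
  have hf : ∀ i, frameFrequency p lam t i = t / t ^ p i * lam i := fun i => by
    rw [frameFrequency, Real.rpow_sub ht, Real.rpow_one]
  have hx : ∀ i, frameShift p X t i = t ^ p i / t * X t i := fun i => by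
    rw [frameShift, Real.rpow_sub ht, Real.rpow_one]
  have hmd : ∀ i, frameMetric p η t i i = η t i i := fun i => by
    rw [hm, div_self (hq i).ne', one_mul]
  have hkd : ∀ i, frameCurvature p η κ t i i = κ t i i := fun i => by
    rw [hk, div_self (hq i).ne']
    ring
  refine ⟨fun i j => ?_, fun i j => ?_, ?_, ?_, fun j => ?_, fun i => ?_, ?_, fun i => ?_⟩
  · have h1 := H.sym_eta t ht i j
    rw [rpow_neg_two_mul ht, rpow_neg_two_mul ht] at h1
    have hi := (hq i).ne'
    have hj := (hq j).ne'
    rw [hm, hm]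
    field_simp at h1 ⊢
    linarith
  · have h1 := H.sym_kappa t ht i j
    have h2 := H.sym_eta t ht i j
    rw [rpow_neg_two_mul ht, rpow_neg_two_mul ht] at h1 h2
    have hi := (hq i).ne'
    have hj := (hq j).ne'
    rw [hk, hk]
    field_simp at h1 h2 ⊢
    linear_combination h1 - (p i + p j) * h2
  · rw [tau_sq ht]
    refine Finset.sum_congr rfl fun i _ => ?_
    rw [hf, rpow_two_sub ht]
    ring
  · simp only [hmd]
    exact H.nu_elliptic t ht
  · have h1 := H.X_elliptic t ht j
    simp only [hmd, rpow_two_sub ht] at h1 ⊢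
    have hj := (hq j).ne'
    have h2 : ∑ q, p q * frameFrequency p lam t q * frameMetric p η t q j
        = t ^ p j / t * ∑ q, p q * (t ^ 2 / (t ^ p q) ^ 2) * lam q * η t q j := by
      rw [Finset.mul_sum]
      refine Finset.sum_congr rfl fun q _ => ?_
      have := (hq q).ne'
      rw [hm, hf]
      field_simp
    rw [h2, hx, hf]
    have h3 : tau p lam t ^ 2 * (t ^ p j / t * X t j)
        = t ^ p j / t * (tau p lam t ^ 2 * X t j) := by ring
    rw [h3, h1]
    field_simp
  · have h1 := H.sh_gauge t ht i
    simp only [hmd]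
    have h2 : ∑ j, frameFrequency p lam t j * frameMetric p η t i j
        = t / t ^ p i * ∑ j, lam j * η t i j := by
      rw [Finset.mul_sum]
      refine Finset.sum_congr rfl fun j _ => ?_
      have := (hq j).ne'
      rw [hm, hf]
      field_simp
    rw [h2, hf]
    linear_combination t / t ^ p i * h1
  · simp only [hmd, hkd]
    exact H.hamiltonian t ht
  · have h1 := H.momentum t ht i
    simp only [hmd]
    have h2 : ∑ j, frameFrequency p lam t j
          * (frameCurvature p η κ t i j - (p i - p j) * frameMetric p η t i j)
        = t / t ^ p i * ∑ j, lam j * κ t i j := by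
      rw [Finset.mul_sum]
      refine Finset.sum_congr rfl fun j _ => ?_
      have := (hq j).ne'
      rw [hm, hk, hf]
      field_simp
      ring
    rw [h2, hf]
    linear_combination t / t ^ p i * h1

lemma hasDerivAt_frameMetric (H : IsCMCSHSolution p pphi lam η κ φ ψ ν X) (ht : 0 < t)
    (i j : Fin D) :
    HasDerivAt (fun s => frameMetric p η s i j)
      ((frameCurvature p η κ t i j
        + metricSource p (frameFrequency p lam t) (frameShift p X t) (ν t) i j) / t) t := by
  refine ((hasDerivAt_rpow_div ht (p j - p i)).mul (H.eta_evol t ht i j)).congr_deriv ?_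
  unfold frameCurvature metricSource frameFrequency frameShift
  simp only [rpow_two_mul_sub ht, Real.rpow_sub ht, Real.rpow_one]
  have hi : t ^ p i ≠ 0 := by positivity
  have hj : t ^ p j ≠ 0 := by positivity
  by_cases hij : i = j
  · subst hij
    simp only [if_true]
    field_simp
    ring
  · simp only [hij, if_false]
    field_simp
    ring

lemma hasDerivAt_frameCurvature (H : IsCMCSHSolution p pphi lam η κ φ ψ ν X) (ht : 0 < t)
    (i j : Fin D) :
    HasDerivAt (fun s => frameCurvature p η κ s i j)
      ((-((tau p lam t ^ 2 - (p i - p j) ^ 2) * frameMetric p η t i j)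
        + (frameFrequency p lam t i * frameFrequency p lam t j * ν t
          + curvatureSource p (frameFrequency p lam t) (frameShift p X t) (ν t) i j)) / t) t := by
  refine ((hasDerivAt_rpow_div ht (p j - p i)).mul ((H.kappa_evol t ht i j).add
    ((H.eta_evol t ht i j).const_mul (p i - p j)))).congr_deriv ?_
  unfold frameMetric curvatureSource frameFrequency frameShift
  simp only [Pi.add_apply, rpow_two_mul_sub ht, rpow_two_sub ht, Real.rpow_sub ht, Real.rpow_one]
  have hi : t ^ p i ≠ 0 := by positivity
  have hj : t ^ p j ≠ 0 := by positivity
  by_cases hij : i = j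
  · subst hij
    simp only [if_true]
    field_simp
    ring
  · simp only [hij, if_false]
    field_simp
    ring

/-- The high-frequency energy in terms of the frame components. -/
lemma EsysHigh_eq (H : IsCMCSHSolution p pphi lam η κ φ ψ ν X) (hlam : lam ≠ 0) (ht : 0 < t) :
    EsysHigh p lam η κ φ ψ t =
      (zeta p lam t ^ 2 * (∑ i, ∑ j, frameCurvature p η κ t i j ^ 2 + ψ t ^ 2)
        + zeta p lam t * (∑ i, ∑ j, frameCurvature p η κ t i j * frameMetric p η t i j + ψ t * φ t)
        + 1 / 2 * (∑ i, ∑ j, frameMetric p η t i j ^ 2 + φ t ^ 2)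
        + zeta p lam t ^ 2 * (tau p lam t ^ 2 * (∑ i, ∑ j, frameMetric p η t i j ^ 2 + φ t ^ 2)
          - ∑ i, ∑ j, (p i - p j) ^ 2 * frameMetric p η t i j ^ 2)) / tau p lam t := by
  have F := H.isFrameMode ht
  have hcancel : ∀ i j, t ^ (p j - p i) * t ^ (p i - p j) = 1 := fun i j => by
    rw [← Real.rpow_add ht]
    simp
  have hη : ∀ i j, η t i j = t ^ (p i - p j) * frameMetric p η t i j := fun i j => by
    rw [frameMetric, ← mul_assoc, hcancel, one_mul]
  have hκ : ∀ i j, κ t i j = t ^ (p i - p j)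
      * (frameCurvature p η κ t i j - (p i - p j) * frameMetric p η t i j) := fun i j => by
    unfold frameCurvature frameMetric
    linear_combination -κ t i j * hcancel j i
  have hκκ : ∑ i, ∑ j, κ t i j * κ t j i = ∑ i, ∑ j, frameCurvature p η κ t i j ^ 2
      - ∑ i, ∑ j, (p i - p j) ^ 2 * frameMetric p η t i j ^ 2 := by
    simp only [← Finset.sum_sub_distrib]
    refine Finset.sum_congr rfl fun i _ => Finset.sum_congr rfl fun j _ => ?_
    rw [hκ i j, hκ j i, F.s_symm j i, F.h_symm j i]
    linear_combination (frameCurvature p η κ t i j ^ 2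
      - (p i - p j) ^ 2 * frameMetric p η t i j ^ 2) * hcancel j i
  have hηη : ∑ i, ∑ j, η t i j * η t j i = ∑ i, ∑ j, frameMetric p η t i j ^ 2 := by
    refine Finset.sum_congr rfl fun i _ => Finset.sum_congr rfl fun j _ => ?_
    rw [hη i j, hη j i, F.h_symm j i]
    linear_combination frameMetric p η t i j ^ 2 * hcancel j i
  have hanti : ∑ i, ∑ j, (p i - p j) * frameMetric p η t i j ^ 2 = 0 := by
    have h1 : ∑ i, ∑ j, (p i - p j) * frameMetric p η t i j ^ 2
        = -∑ i, ∑ j, (p i - p j) * frameMetric p η t i j ^ 2 := by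
      conv_lhs => rw [Finset.sum_comm]
      simp only [← Finset.sum_neg_distrib]
      refine Finset.sum_congr rfl fun i _ => Finset.sum_congr rfl fun j _ => ?_
      rw [F.h_symm j i]
      ring
    linarith
  have hκη : ∑ i, ∑ j, κ t i j * η t j i
      = ∑ i, ∑ j, frameCurvature p η κ t i j * frameMetric p η t i j := by
    rw [← sub_zero (∑ i, ∑ j, frameCurvature p η κ t i j * frameMetric p η t i j), ← hanti]
    simp only [← Finset.sum_sub_distrib]
    refine Finset.sum_congr rfl fun i _ => Finset.sum_congr rfl fun j _ => ?_
    rw [hκ i j, hη j i, F.h_symm j i]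
    linear_combination (frameCurvature p η κ t i j * frameMetric p η t i j
      - (p i - p j) * frameMetric p η t i j ^ 2) * hcancel j i
  have hτ := tau_pos (p := p) hlam ht
  rw [EsysHigh, hκκ, hκη, hηη]
  field_simp
  ring

lemma hasDerivAt_EsysHigh {K z : ℝ} (H : IsCMCSHSolution p pphi lam η κ φ ψ ν X)
    (hp : ∀ i, |p i| ≤ 1) (hK : ∀ i, 1 ≤ K * (1 - p i)) (hlam : lam ≠ 0) (ht : 0 < t)
    (hz : HasDerivAt (zeta p lam) z t) {A B C M RA RB RC RM : ℝ} {h s : Fin D → Fin D → ℝ}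
    {l x : Fin D → ℝ} {ζ τ : ℝ} (hh : h = frameMetric p η t) (hs : s = frameCurvature p η κ t)
    (hl : l = frameFrequency p lam t) (hx : x = frameShift p X t) (hζ : ζ = zeta p lam t)
    (hτ : τ = tau p lam t)
    (hA : A = ∑ i, ∑ j, s i j ^ 2 + ψ t ^ 2) (hB : B = ∑ i, ∑ j, s i j * h i j + ψ t * φ t)
    (hC : C = ∑ i, ∑ j, h i j ^ 2 + φ t ^ 2) (hM : M = ∑ i, ∑ j, (p i - p j) ^ 2 * h i j ^ 2)
    (hRA : RA = (∑ i, ∑ j, s i j * (l i * l j * ν t + curvatureSource p l x (ν t) i j))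
      + ψ t * (-(pphi * ν t)))
    (hRB : RB = (∑ i, ∑ j, s i j * metricSource p l x (ν t) i j)
      + (∑ i, ∑ j, h i j * (l i * l j * ν t + curvatureSource p l x (ν t) i j))
      + pphi * ν t * ψ t + φ t * (-(pphi * ν t)))
    (hRC : RC = (∑ i, ∑ j, h i j * metricSource p l x (ν t) i j) + φ t * (pphi * ν t))
    (hRM : RM = ∑ i, ∑ j, (p i - p j) ^ 2 * h i j * metricSource p l x (ν t) i j) :
    HasDerivAt (EsysHigh p lam η κ φ ψ)
      ((t * z * (2 * ζ * A + B + 2 * ζ * (τ ^ 2 * C - M)) + 2 * ζ * M - C / (2 * ζ)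
        + 2 * ζ ^ 2 * RA + ζ * RB + RC + 2 * ζ ^ 2 * τ ^ 2 * RC - 2 * ζ ^ 2 * RM) / (τ * t)) t := by
  have hh' := fun i j => H.hasDerivAt_frameMetric ht i j
  have hs' := fun i j => H.hasDerivAt_frameCurvature ht i j
  have hφ' := H.phi_evol t ht
  have hψ' := H.psi_evol t ht
  have hτ' := hasDerivAt_tau hp hK hlam ht
  have hτ0 := tau_pos (p := p) hlam ht
  have hζ0 : 0 < zeta p lam t := by linarith [half_le_zeta hp hK hlam ht]
  have hevent : EsysHigh p lam η κ φ ψ =ᶠ[𝓝 t] fun t =>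
      (zeta p lam t ^ 2 * (∑ i, ∑ j, frameCurvature p η κ t i j ^ 2 + ψ t ^ 2)
        + zeta p lam t * (∑ i, ∑ j, frameCurvature p η κ t i j * frameMetric p η t i j + ψ t * φ t)
        + 1 / 2 * (∑ i, ∑ j, frameMetric p η t i j ^ 2 + φ t ^ 2)
        + zeta p lam t ^ 2 * (tau p lam t ^ 2 * (∑ i, ∑ j, frameMetric p η t i j ^ 2 + φ t ^ 2)
          - ∑ i, ∑ j, (p i - p j) ^ 2 * frameMetric p η t i j ^ 2)) / tau p lam t := by
    filter_upwards [Ioi_mem_nhds ht] with r hr using H.EsysHigh_eq hlam hr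
  refine HasDerivAt.congr_of_eventuallyEq ?_ hevent
  rw [← hh, ← hl, ← hx] at hs'
  rw [← hs, ← hl, ← hx] at hh'
  rw [← hτ] at hs' hψ' hτ' hτ0
  rw [← hζ] at hτ' hζ0
  have hA' : HasDerivAt (fun t => ∑ i, ∑ j, frameCurvature p η κ t i j ^ 2 + ψ t ^ 2)
      ((-(2 * τ ^ 2 * B) + 2 * (∑ i, ∑ j, (p i - p j) ^ 2 * (s i j * h i j)) + 2 * RA) / t) t := by
    refine ((HasDerivAt.fun_sum fun i _ => HasDerivAt.fun_sum fun j _ =>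
      (hs' i j).fun_pow 2).add (hψ'.fun_pow 2)).congr_deriv ?_
    rw [← hs, hRA, hB]
    have : ∀ i j, ((2 : ℕ) : ℝ) * s i j ^ (2 - 1) * ((-((τ ^ 2 - (p i - p j) ^ 2) * h i j)
        + (l i * l j * ν t + curvatureSource p l x (ν t) i j)) / t)
        = (-(2 * τ ^ 2) / t) * (s i j * h i j) + 2 / t * ((p i - p j) ^ 2 * (s i j * h i j))
          + 2 / t * (s i j * (l i * l j * ν t + curvatureSource p l x (ν t) i j)) := by
      intro i j
      push_cast
      ring
    simp only [this, Finset.sum_add_distrib, ← Finset.mul_sum]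
    push_cast
    ring
  have hB' : HasDerivAt (fun t => ∑ i, ∑ j, frameCurvature p η κ t i j * frameMetric p η t i j
        + ψ t * φ t) ((A - τ ^ 2 * C + M + RB) / t) t := by
    refine ((HasDerivAt.fun_sum fun i _ => HasDerivAt.fun_sum fun j _ =>
      (hs' i j).fun_mul (hh' i j)).add (hψ'.fun_mul hφ')).congr_deriv ?_
    rw [← hs, ← hh, hRB, hA, hC, hM]
    have : ∀ i j, (-((τ ^ 2 - (p i - p j) ^ 2) * h i j)
        + (l i * l j * ν t + curvatureSource p l x (ν t) i j)) / t * h i j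
        + s i j * ((s i j + metricSource p l x (ν t) i j) / t)
        = 1 / t * s i j ^ 2 + (-(τ ^ 2) / t) * h i j ^ 2 + 1 / t * ((p i - p j) ^ 2 * h i j ^ 2)
          + 1 / t * (s i j * metricSource p l x (ν t) i j)
          + 1 / t * (h i j * (l i * l j * ν t + curvatureSource p l x (ν t) i j)) := by
      intro i j
      ring
    simp only [this, Finset.sum_add_distrib, ← Finset.mul_sum]
    ring
  have hC' : HasDerivAt (fun t => ∑ i, ∑ j, frameMetric p η t i j ^ 2 + φ t ^ 2)
      ((2 * B + 2 * RC) / t) t := by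
    refine ((HasDerivAt.fun_sum fun i _ => HasDerivAt.fun_sum fun j _ =>
      (hh' i j).fun_pow 2).add (hφ'.fun_pow 2)).congr_deriv ?_
    rw [← hh, hRC, hB]
    have : ∀ i j, ((2 : ℕ) : ℝ) * h i j ^ (2 - 1) * ((s i j + metricSource p l x (ν t) i j) / t)
        = 2 / t * (s i j * h i j) + 2 / t * (h i j * metricSource p l x (ν t) i j) := by
      intro i j
      push_cast
      ring
    simp only [this, Finset.sum_add_distrib, ← Finset.mul_sum]
    push_cast
    ring
  have hM' : HasDerivAt (fun t => ∑ i, ∑ j, (p i - p j) ^ 2 * frameMetric p η t i j ^ 2)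
      ((2 * (∑ i, ∑ j, (p i - p j) ^ 2 * (s i j * h i j)) + 2 * RM) / t) t := by
    refine (HasDerivAt.fun_sum fun i _ => HasDerivAt.fun_sum fun j _ =>
      ((hh' i j).fun_pow 2).const_mul ((p i - p j) ^ 2)).congr_deriv ?_
    rw [← hh, hRM]
    have : ∀ i j, (p i - p j) ^ 2 * (((2 : ℕ) : ℝ) * h i j ^ (2 - 1)
          * ((s i j + metricSource p l x (ν t) i j) / t))
        = 2 / t * ((p i - p j) ^ 2 * (s i j * h i j))
          + 2 / t * ((p i - p j) ^ 2 * h i j * metricSource p l x (ν t) i j) := by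
      intro i j
      push_cast
      ring
    simp only [this, Finset.sum_add_distrib, ← Finset.mul_sum]
    ring
  have hz2 := hz.fun_pow 2
  refine (((((hz2.fun_mul hA').fun_add (hz.fun_mul hB')).fun_add (hC'.const_mul (1 / 2))).fun_add
    (hz2.fun_mul (((hτ'.fun_pow 2).fun_mul hC').fun_sub hM'))).fun_div hτ'
    (hτ ▸ hτ0.ne')).congr_deriv ?_
  rw [← hh, ← hs, ← hA, ← hB, ← hC, ← hM, ← hζ, ← hτ]
  push_cast
  field_simp
  ring

end IsCMCSHSolution

end Frame

lemma tau_mono {D : ℕ} {p : Fin D → ℝ} (lam : Fin D → ℤ) (hp : ∀ i, |p i| ≤ 1) {a b : ℝ}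
    (ha : 0 < a) (hab : a ≤ b) : tau p lam a ≤ tau p lam b := by
  refine Real.sqrt_le_sqrt (Finset.sum_le_sum fun i _ => ?_)
  have := (abs_le.1 (hp i)).2
  have : 0 ≤ 2 - 2 * p i := by linarith
  gcongr

/-- A two-sided Grönwall inequality for a function whose logarithmic derivative is dominated by
the derivative of `g`. -/
lemma gronwall_two_sided {f f' g g' : ℝ → ℝ} {a b : ℝ} (hab : a ≤ b)
    (hf : ∀ t ∈ Set.Icc a b, HasDerivAt f (f' t) t) (hg : ∀ t ∈ Set.Icc a b, HasDerivAt g (g' t) t)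
    (hbound : ∀ t ∈ Set.Icc a b, |f' t| ≤ g' t * f t) :
    f b ≤ Real.exp (g b - g a) * f a ∧ f a ≤ Real.exp (g b - g a) * f b := by
  have hdown : ∀ t ∈ Set.Icc a b, HasDerivAt (fun s => f s * Real.exp (-g s))
      ((f' t - g' t * f t) * Real.exp (-g t)) t := fun t ht =>
    ((hf t ht).fun_mul (hg t ht).fun_neg.exp).congr_deriv (by ring)
  have hup : ∀ t ∈ Set.Icc a b, HasDerivAt (fun s => f s * Real.exp (g s))
      ((f' t + g' t * f t) * Real.exp (g t)) t := fun t ht =>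
    ((hf t ht).fun_mul (hg t ht).exp).congr_deriv (by ring)
  have hanti : AntitoneOn (fun s => f s * Real.exp (-g s)) (Set.Icc a b) :=
    antitoneOn_of_hasDerivWithinAt_nonpos (convex_Icc a b)
      (fun t ht => (hdown t ht).continuousAt.continuousWithinAt)
      (fun t ht => (hdown t (interior_subset ht)).hasDerivWithinAt)
      fun t ht => mul_nonpos_of_nonpos_of_nonneg
        (by linarith [(abs_le.1 (hbound t (interior_subset ht))).2]) (Real.exp_pos _).le
  have hmono : MonotoneOn (fun s => f s * Real.exp (g s)) (Set.Icc a b) :=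
    monotoneOn_of_hasDerivWithinAt_nonneg (convex_Icc a b)
      (fun t ht => (hup t ht).continuousAt.continuousWithinAt)
      (fun t ht => (hup t (interior_subset ht)).hasDerivWithinAt)
      fun t ht => mul_nonneg
        (by linarith [(abs_le.1 (hbound t (interior_subset ht))).1]) (Real.exp_pos _).le
  have h1 := hanti (Set.left_mem_Icc.2 hab) (Set.right_mem_Icc.2 hab) hab
  have h2 := hmono (Set.left_mem_Icc.2 hab) (Set.right_mem_Icc.2 hab) hab
  simp only [Real.exp_neg] at h1
  have ea := Real.exp_pos (g a)
  have eb := Real.exp_pos (g b)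
  rw [Real.exp_sub]
  constructor
  · field_simp at h1 ⊢
    linarith
  · field_simp
    linarith

namespace IsCMCSHSolution

variable {D : ℕ} {p : Fin D → ℝ} {pphi K : ℝ} {lam : Fin D → ℤ} {η κ : ℝ → Fin D → Fin D → ℝ}
  {φ ψ ν : ℝ → ℝ} {X : ℝ → Fin D → ℝ}

lemma energy_estimate (H : IsCMCSHSolution p pphi lam η κ φ ψ ν X) (hD : 1 ≤ D)
    (hp : ∀ i, |p i| ≤ 1) (hpphi : |pphi| ≤ 1) (hK1 : 1 ≤ K) (hK : ∀ i, 1 ≤ K * (1 - p i))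
    (hlam : lam ≠ 0) {t : ℝ} (ht : 0 < t) (hτ : 3 ≤ tau p lam t) :
    0 ≤ EsysHigh p lam η κ φ ψ t ∧ ∃ E', HasDerivAt (EsysHigh p lam η κ φ ψ) E' t ∧
      |t * E'| ≤ 8000 * K ^ 2 * (D : ℝ) ^ 3 * (t * |deriv (zeta p lam) t| + (tau p lam t)⁻¹)
        * EsysHigh p lam η κ φ ψ t := by
  obtain ⟨z, hz, -⟩ := exists_hasDerivAt_zeta_nonpos hp hK hlam ht
  have hτ0 : 0 < tau p lam t := tau_pos hlam ht
  obtain ⟨h0, hle⟩ := (H.isFrameMode ht).energy_rate_le (z := t * z) hD hp hpphi hτ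
    (half_le_zeta hp hK hlam ht) (zeta_le hp hK hlam ht) hK1 rfl rfl rfl rfl rfl rfl rfl rfl
  have hE := H.EsysHigh_eq hlam ht
  refine ⟨hE ▸ div_nonneg h0 hτ0.le, _, H.hasDerivAt_EsysHigh hp hK hlam ht hz
    rfl rfl rfl rfl rfl rfl rfl rfl rfl rfl rfl rfl rfl rfl, ?_⟩
  rw [abs_mul, abs_of_pos ht] at hle
  rw [hz.deriv, hE, mul_div_assoc', mul_comm _ t, mul_div_mul_left _ _ ht.ne', abs_div,
    abs_of_pos hτ0, ← mul_div_assoc]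
  gcongr

lemma energy_comparison (H : IsCMCSHSolution p pphi lam η κ φ ψ ν X) (hD : 1 ≤ D)
    (hp : ∀ i, |p i| ≤ 1) (hpphi : |pphi| ≤ 1) (hK1 : 1 ≤ K) (hK : ∀ i, 1 ≤ K * (1 - p i))
    (hlam : lam ≠ 0) {a b : ℝ} (ha : 0 < a) (hab : a ≤ b) (hτ : 3 ≤ tau p lam a) :
    EsysHigh p lam η κ φ ψ b
      ≤ Real.exp (8000 * K ^ 2 * (D : ℝ) ^ 3 * (2 * K)) * EsysHigh p lam η κ φ ψ a ∧
    EsysHigh p lam η κ φ ψ a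
      ≤ Real.exp (8000 * K ^ 2 * (D : ℝ) ^ 3 * (2 * K)) * EsysHigh p lam η κ φ ψ b := by
  set C := 8000 * K ^ 2 * (D : ℝ) ^ 3 with hC
  have hC0 : 0 ≤ C := by positivity
  have hpos : ∀ t ∈ Set.Icc a b, 0 < t := fun t ht => ha.trans_le ht.1
  have hlarge : ∀ t ∈ Set.Icc a b, 3 ≤ tau p lam t := fun t ht =>
    hτ.trans (tau_mono lam hp ha ht.1)
  have hgron := gronwall_two_sided hab (f := EsysHigh p lam η κ φ ψ)
    (f' := deriv (EsysHigh p lam η κ φ ψ))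
    (g := fun t => C * (-zeta p lam t - K * (tau p lam t)⁻¹))
    (g' := fun t => C * (-deriv (zeta p lam) t + K / (tau p lam t * zeta p lam t * t)))
    (fun t ht => by
      obtain ⟨-, E', hE', -⟩ :=
        H.energy_estimate hD hp hpphi hK1 hK hlam (hpos t ht) (hlarge t ht)
      exact hE'.differentiableAt.hasDerivAt)
    (fun t ht => by
      have ht0 := hpos t ht
      obtain ⟨z, hz, -⟩ := exists_hasDerivAt_zeta_nonpos hp hK hlam ht0
      have hτ0 : 0 < tau p lam t := tau_pos hlam ht0
      have hζ0 : 0 < zeta p lam t := by linarith [half_le_zeta hp hK hlam ht0]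
      rw [hz.deriv]
      refine ((hz.fun_neg.fun_sub (((hasDerivAt_tau hp hK hlam ht0).fun_inv hτ0.ne').const_mul
        K)).const_mul C).congr_deriv ?_
      field_simp
      ring)
    (fun t ht => by
      have ht0 := hpos t ht
      obtain ⟨z, hz, hz0⟩ := exists_hasDerivAt_zeta_nonpos hp hK hlam ht0
      obtain ⟨hE0, E', hE', hle⟩ :=
        H.energy_estimate hD hp hpphi hK1 hK hlam ht0 (hlarge t ht)
      have hτ0 : 0 < tau p lam t := tau_pos hlam ht0
      have hζ0 : 0 < zeta p lam t := by linarith [half_le_zeta hp hK hlam ht0]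
      have hζK := zeta_le hp hK hlam ht0
      rw [hz.deriv, abs_mul, abs_of_pos ht0, abs_of_nonpos hz0, ← hC] at hle
      rw [hE'.deriv, hz.deriv]
      refine le_of_mul_le_mul_left (hle.trans ?_) ht0
      have h1 : (tau p lam t)⁻¹ ≤ t * (K / (tau p lam t * zeta p lam t * t)) := by
        rw [← sub_nonneg]
        have : t * (K / (tau p lam t * zeta p lam t * t)) - (tau p lam t)⁻¹
            = (K - zeta p lam t) / (tau p lam t * zeta p lam t) := by
          field_simp
        rw [this]
        exact div_nonneg (by linarith) (by positivity)
      have h2 := mul_le_mul_of_nonneg_left h1 (mul_nonneg hC0 hE0)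
      linarith)
  have hb : 0 < b := ha.trans_le hab
  have hKτ : K * (tau p lam a)⁻¹ ≤ K :=
    mul_le_of_le_one_right (by linarith) (inv_le_one_of_one_le₀ (by linarith))
  have hKτ' : 0 ≤ K * (tau p lam b)⁻¹ :=
    mul_nonneg (by linarith) (inv_nonneg.2 (tau_pos hlam hb).le)
  have hexp : Real.exp (C * (-zeta p lam b - K * (tau p lam b)⁻¹)
      - C * (-zeta p lam a - K * (tau p lam a)⁻¹)) ≤ Real.exp (C * (2 * K)) := by
    refine Real.exp_le_exp.2 ?_
    rw [← mul_sub]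
    refine mul_le_mul_of_nonneg_left ?_ hC0
    linarith [half_le_zeta hp hK hlam hb, zeta_le hp hK hlam ha]
  have hEa := (H.energy_estimate hD hp hpphi hK1 hK hlam ha hτ).1
  have hEb := (H.energy_estimate hD hp hpphi hK1 hK hlam hb
    (hlarge b (Set.right_mem_Icc.2 hab))).1
  exact ⟨hgron.1.trans (mul_le_mul_of_nonneg_right hexp hEa),
    hgron.2.trans (mul_le_mul_of_nonneg_right hexp hEb)⟩

end IsCMCSHSolution

/-- Proposition `prop:einstein_high_freq`: the high-frequency energy estimate for the
linearized Einstein–scalar field system in CMCSH gauge, for τ(t) ≥ τ̊ with τ̊ as in the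
coercivity of the high-frequency Einstein energy. -/
theorem einstein_high_freq_energy_estimate (D : ℕ) (hD : 2 ≤ D)
    (p : Fin D → ℝ) (pphi : ℝ)
    (hkas1 : ∑ i, p i = 1) (hkas2 : (∑ i, p i ^ 2) + 2 * pphi ^ 2 = 1)
    (hp : ∀ i, p i < 1) :
    ∃ taumid : ℝ, 1 ≤ taumid ∧
      (∃ C : ℝ, 0 < C ∧
        ∀ (lam : Fin D → ℤ), lam ≠ 0 →
        ∀ (η κ : ℝ → Fin D → Fin D → ℝ) (φ ψ ν : ℝ → ℝ) (X : ℝ → Fin D → ℝ),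
          IsCMCSHSolution p pphi lam η κ φ ψ ν X →
        ∀ t : ℝ, 0 < t → taumid ≤ tau p lam t →
          ∃ E' : ℝ, HasDerivAt (EsysHigh p lam η κ φ ψ) E' t ∧
            |t * E'| ≤ C * (t * |deriv (zeta p lam) t| + (tau p lam t)⁻¹)
                * EsysHigh p lam η κ φ ψ t) ∧
      (∃ Chigh : ℝ, 0 < Chigh ∧
        ∀ (lam : Fin D → ℤ), lam ≠ 0 →
        ∀ (η κ : ℝ → Fin D → Fin D → ℝ) (φ ψ ν : ℝ → ℝ) (X : ℝ → Fin D → ℝ),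
          IsCMCSHSolution p pphi lam η κ φ ψ ν X →
        taumid ≤ tau p lam 1 →
        ∀ t : ℝ, 0 < t → taumid ≤ tau p lam t →
          Chigh⁻¹ * EsysHigh p lam η κ φ ψ t ≤ EsysHigh p lam η κ φ ψ 1 ∧
          EsysHigh p lam η κ φ ψ 1 ≤ Chigh * EsysHigh p lam η κ φ ψ t) := by
  have hp1 : ∀ i, |p i| ≤ 1 := fun i => by
    have := Finset.single_le_sum (f := fun i => p i ^ 2) (fun _ _ => sq_nonneg _)
      (Finset.mem_univ i)
    exact abs_le_of_sq_le_sq (by linarith [sq_nonneg pphi]) zero_le_one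
  have hpphi : |pphi| ≤ 1 := by
    have : 0 ≤ ∑ i, p i ^ 2 := by positivity
    exact abs_le_of_sq_le_sq (by nlinarith) zero_le_one
  have hinv : ∀ i, 0 < (1 - p i)⁻¹ := fun i => inv_pos.2 (by linarith [hp i])
  set K : ℝ := 1 + ∑ i, (1 - p i)⁻¹ with hK_def
  have hK1 : 1 ≤ K := le_add_of_nonneg_right (Finset.sum_nonneg fun i _ => (hinv i).le)
  have hK : ∀ i, 1 ≤ K * (1 - p i) := fun i => by
    have h1 : (1 - p i)⁻¹ ≤ K := by
      have := Finset.single_le_sum (f := fun i => (1 - p i)⁻¹) (fun i _ => (hinv i).le)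
        (Finset.mem_univ i)
      linarith
    exact (inv_le_iff_one_le_mul₀ (by linarith [hp i])).1 h1
  have hD1 : 1 ≤ D := by omega
  have hD0 : (0 : ℝ) < D := by exact_mod_cast hD1
  refine ⟨3, by norm_num, ⟨8000 * K ^ 2 * (D : ℝ) ^ 3, by positivity, ?_⟩,
    Real.exp (8000 * K ^ 2 * (D : ℝ) ^ 3 * (2 * K)), Real.exp_pos _, ?_⟩
  · intro lam hlam η κ φ ψ ν X H t ht hτ
    exact (H.energy_estimate hD1 hp1 hpphi hK1 hK hlam ht hτ).2
  · intro lam hlam η κ φ ψ ν X H hτ1 t ht hτ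
    rw [inv_mul_le_iff₀ (Real.exp_pos _)]
    rcases le_total t 1 with h | h
    · have := H.energy_comparison hD1 hp1 hpphi hK1 hK hlam ht h hτ
      exact ⟨this.2, this.1⟩
    · exact H.energy_comparison hD1 hp1 hpphi hK1 hK hlam one_pos h hτ1
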